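/- arXiv:0802.3284 — 3 statements merged into one kernel-verified Lean document; each statement's English description precedes it below -/
import Mathlib

section
/- For every tree T on n vertices, F(T) ≥ f_{n+2} (the (n+2)-nd Fibonacci number), with equality if and only if T is the path P_n. -/
open Finset
open scoped Classical

/-- The Fibonacci index: the number of independent (stable) sets of `G`,
including the empty set. -/
noncomputable def fibIndex {V : Type*} [Fintype V] (G : SimpleGraph V) : ℕ :=
  (Finset.univ.filter fun s : Finset V => ∀ a ∈ s, ∀ b ∈ s, ¬ G.Adj a b).card

/-- The independence (stability) number of `G`. -/
noncomputable def indepNum {V : Type*} [Fintype V] (G : SimpleGraph V) : ℕ :=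
  (Finset.univ.filter fun s : Finset V => ∀ a ∈ s, ∀ b ∈ s, ¬ G.Adj a b).sup Finset.card

namespace FibTree

variable {V : Type*} [Fintype V]

/-- Number of independent subsets of `S`. -/
noncomputable def I (G : SimpleGraph V) (S : Finset V) : ℕ :=
  (S.powerset.filter fun s : Finset V => ∀ a ∈ s, ∀ b ∈ s, ¬ G.Adj a b).card

/-- Neighbours of `v` within `S`. -/
noncomputable def N (G : SimpleGraph V) (S : Finset V) (v : V) : Finset V :=
  S.filter fun x => G.Adj v x

/-- Twice the number of edges within `S`. -/
noncomputable def E (G : SimpleGraph V) (S : Finset V) : ℕ :=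
  ∑ a ∈ S, ∑ b ∈ S, if G.Adj a b then 1 else 0

/-- `f` enumerates `S` as an induced path with `n` vertices. -/
def P (G : SimpleGraph V) (f : ℕ → V) (n : ℕ) (S : Finset V) : Prop :=
  (∀ i < n, ∀ j < n, f i = f j → i = j) ∧ (∀ x, x ∈ S ↔ ∃ i < n, f i = x) ∧
    ∀ i < n, ∀ j < n, (G.Adj (f i) (f j) ↔ i + 1 = j ∨ j + 1 = i)

lemma I_empty (G : SimpleGraph V) : I G ∅ = 1 := by
  simp [I, Finset.filter_singleton]

lemma I_mono (G : SimpleGraph V) {S T : Finset V} (h : S ⊆ T) : I G S ≤ I G T := by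
  unfold I
  exact Finset.card_le_card (Finset.filter_subset_filter _ (Finset.powerset_mono.2 h))

lemma I_rec (G : SimpleGraph V) {S : Finset V} {v : V} (hv : v ∈ S) :
    I G S = I G (S.erase v) + I G (S.erase v \ N G S v) := by
  unfold I
  rw [← Finset.card_filter_add_card_filter_not (fun s : Finset V => v ∉ s)]
  congr 1
  · congr 1
    ext s
    simp only [Finset.mem_filter, Finset.mem_powerset, Finset.subset_erase]
    tauto
  · symm
    apply Finset.card_bij (fun s _ => insert v s)
    · intro s hs
      simp only [N, Finset.mem_filter, Finset.mem_powerset, Finset.subset_iff, Finset.mem_sdiff,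
        Finset.mem_erase, Finset.mem_insert] at hs ⊢
      have h1 := fun a b => G.adj_comm a b
      have h2 := fun a => G.irrefl (v := a)
      grind
    · intro s hs t ht hst
      simp only [N, Finset.mem_filter, Finset.mem_powerset, Finset.subset_iff, Finset.mem_sdiff,
        Finset.mem_erase] at hs ht
      ext x
      have := congrArg (fun u => x ∈ u) hst
      simp only [Finset.mem_insert] at this
      grind
    · intro s hs
      simp only [Finset.mem_filter, Finset.mem_powerset, not_not] at hs
      refine ⟨s.erase v, ?_, Finset.insert_erase hs.2⟩
      simp only [N, Finset.mem_filter, Finset.mem_powerset, Finset.subset_iff, Finset.mem_sdiff,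
        Finset.mem_erase] at hs ⊢
      grind

lemma N_erase (G : SimpleGraph V) (S : Finset V) (v : V) : N G (S.erase v) v = N G S v := by
  ext x
  simp only [N, Finset.mem_filter, Finset.mem_erase]
  exact ⟨fun a => ⟨a.1.2, a.2⟩, fun a => ⟨⟨a.2.ne', a.1⟩, a.2⟩⟩

lemma E_rec (G : SimpleGraph V) {S : Finset V} {v : V} (hv : v ∈ S) :
    E G S = E G (S.erase v) + 2 * (N G (S.erase v) v).card := by
  have hS : S = insert v (S.erase v) := (Finset.insert_erase hv).symm
  have hn : v ∉ S.erase v := Finset.notMem_erase v S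
  generalize S.erase v = T at *
  subst hS
  unfold E N
  simp only [Finset.sum_insert hn, Finset.sum_add_distrib, Finset.card_filter,
    SimpleGraph.irrefl, if_false, G.adj_comm _ v]
  ring

lemma exists_leaf {W : Type*} [Finite W] [Nonempty W] {H : SimpleGraph W} (h : H.IsAcyclic) :
    ∃ v, ∀ a b, H.Adj v a → H.Adj v b → a = b := by
  have ⟨u, v, p, hp, hmax⟩ := SimpleGraph.Walk.exists_isPath_forall_isPath_length_le_length H
  have key : ∀ w, H.Adj v w → w = p.penultimate := by
    intro w hadj
    apply h.eq_penultimate_of_adj_end hp hadj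
    have : ¬(p.concat hadj).IsPath := by grind [SimpleGraph.Walk.length_concat]
    grind [hp.concat]
  exact ⟨v, fun a b ha hb => (key a ha).trans (key b hb).symm⟩

lemma exists_leaf' {G : SimpleGraph V} (h : G.IsAcyclic) {S : Finset V} (hS : S.Nonempty) :
    ∃ v ∈ S, N G S v = ∅ ∨ ∃ u ∈ S, u ≠ v ∧ N G S v = {u} := by
  obtain ⟨x, hx⟩ := hS
  have : Nonempty (↑S : Set V) := ⟨⟨x, hx⟩⟩
  obtain ⟨⟨v, hv⟩, hv'⟩ := exists_leaf (h.induce (↑S : Set V))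
  refine ⟨v, hv, ?_⟩
  rcases (N G S v).eq_empty_or_nonempty with h0 | ⟨u, hu⟩
  · exact Or.inl h0
  · right
    have hu' := hu
    simp only [N, Finset.mem_filter] at hu'
    refine ⟨u, hu'.1, hu'.2.ne', ?_⟩
    ext y
    simp only [Finset.mem_singleton]
    constructor
    · intro hy
      simp only [N, Finset.mem_filter] at hy
      have := hv' ⟨y, hy.1⟩ ⟨u, hu'.1⟩ (by simpa using hy.2) (by simpa using hu'.2)
      simpa using this
    · rintro rfl; exact hu

lemma lower {G : SimpleGraph V} (h : G.IsAcyclic) (n : ℕ) : ∀ S : Finset V, S.card = n →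
    Nat.fib (n + 2) ≤ I G S := by
  induction n using Nat.strong_induction_on with
  | _ n ih =>
    intro S hS
    rcases S.eq_empty_or_nonempty with rfl | hne
    · simp at hS; subst hS; simp [I_empty]
    obtain ⟨v, hv, hc⟩ := exists_leaf' h hne
    have hpos := Finset.card_pos.2 hne
    have hce := Finset.card_erase_of_mem hv
    rw [I_rec G hv]
    obtain ⟨m, rfl⟩ : ∃ m, n = m + 1 := ⟨n - 1, by omega⟩
    have h1 := ih m (by omega) (S.erase v) (by omega)
    have hf : Nat.fib (m + 1 + 2) = Nat.fib (m + 1) + Nat.fib (m + 2) := Nat.fib_add_two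
    rcases hc with hc | ⟨u, hu, huv, hc⟩
    · rw [hc, Finset.sdiff_empty]
      have : Nat.fib (m + 1) ≤ Nat.fib (m + 2) := Nat.fib_le_fib_succ
      omega
    · rw [hc, Finset.sdiff_singleton_eq_erase]
      have hue : u ∈ S.erase v := Finset.mem_erase.2 ⟨huv, hu⟩
      have hce2 := Finset.card_erase_of_mem hue
      have := Finset.card_pos.2 ⟨u, hue⟩
      obtain ⟨k, rfl⟩ : ∃ k, m = k + 1 := ⟨m - 1, by omega⟩
      have h2 := ih k (by omega) ((S.erase v).erase u) (by omega)
      have hf : Nat.fib (k + 1 + 1 + 2) = Nat.fib (k + 2) + Nat.fib (k + 1 + 2) := Nat.fib_add_two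
      omega

lemma path_I {G : SimpleGraph V} (n : ℕ) : ∀ (f : ℕ → V) (S : Finset V), P G f n S →
    I G S = Nat.fib (n + 2) := by
  induction n using Nat.strong_induction_on with
  | _ n ih =>
    rintro f S ⟨h1, h2, h3⟩
    rcases n with _ | m
    · have : S = ∅ := by ext x; simp [h2]
      subst this; simp [I_empty]
    have hv : f m ∈ S := (h2 _).2 ⟨m, by omega, rfl⟩
    have hP1 : P G f m (S.erase (f m)) := by
      refine ⟨by grind, ?_, by grind⟩
      intro x
      rw [Finset.mem_erase, h2]
      grind
    rw [I_rec G hv, ih m (by omega) _ _ hP1]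
    rcases m with _ | k
    · have : S.erase (f 0) = ∅ := by ext x; simp [hP1.2.1]
      rw [this]; simp [I_empty]; decide
    have hP2 : P G f k (S.erase (f (k + 1)) \ N G S (f (k + 1))) := by
      refine ⟨by grind, ?_, by grind⟩
      intro x
      rw [Finset.mem_sdiff, hP1.2.1, N, Finset.mem_filter, h2]
      grind
    rw [ih k (by omega) _ _ hP2]
    have hf : Nat.fib (k + 1 + 1 + 2) = Nat.fib (k + 2) + Nat.fib (k + 1 + 2) := Nat.fib_add_two
    omega

lemma extend {G : SimpleGraph V} {f : ℕ → V} {m : ℕ} {T : Finset V} (hP : P G f m T) {u v : V}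
    (hu : u ∈ T) (hd : (N G T u).card ≤ 1) (hv : v ∉ T) (hadj : ∀ x ∈ T, G.Adj v x ↔ x = u) :
    ∃ g, P G g (m + 1) (insert v T) := by
  -- first arrange that `u` is the last vertex
  obtain ⟨f, hP, hm, hlast⟩ : ∃ f, P G f m T ∧ 0 < m ∧ f (m - 1) = u := by
    obtain ⟨h1, h2, h3⟩ := hP
    obtain ⟨i, hi, rfl⟩ := (h2 _).1 hu
    by_cases hl : i = m - 1
    · subst hl; exact ⟨f, ⟨h1, h2, h3⟩, by omega, rfl⟩
    have hi0 : i = 0 := by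
      by_contra h0
      have := Finset.card_le_one.1 hd (f (i - 1))
        (by rw [N, Finset.mem_filter, h3 _ hi _ (by omega)]
            exact ⟨(h2 _).2 ⟨_, by omega, rfl⟩, by omega⟩) (f (i + 1))
        (by rw [N, Finset.mem_filter, h3 _ hi _ (by omega)]
            exact ⟨(h2 _).2 ⟨_, by omega, rfl⟩, by omega⟩)
      have := h1 _ (by omega) _ (by omega) this
      omega
    subst hi0
    refine ⟨fun k => f (m - 1 - k), ⟨?_, ?_, ?_⟩, hi, by simp⟩
    · intro i hi j hj h
      have := h1 (m - 1 - i) (by omega) (m - 1 - j) (by omega) h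
      omega
    · intro x
      rw [h2]
      constructor
      · rintro ⟨i, hi, rfl⟩
        exact ⟨m - 1 - i, by omega, by
          show f (m - 1 - (m - 1 - i)) = f i
          congr 1; omega⟩
      · rintro ⟨i, hi, rfl⟩
        exact ⟨m - 1 - i, by omega, rfl⟩
    · intro i hi j hj
      rw [h3 _ (by omega) _ (by omega)]
      omega
  obtain ⟨h1, h2, h3⟩ := hP
  have hT : ∀ i < m, f i ∈ T := fun i hi => (h2 _).2 ⟨i, hi, rfl⟩
  have hA : ∀ i < m, (G.Adj v (f i) ↔ i + 1 = m) := by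
    intro i hi
    rw [hadj _ (hT i hi), ← hlast]
    constructor
    · intro h
      have := h1 _ hi _ (by omega) h
      omega
    · rintro rfl; simp
  have hA' : ∀ i < m, (G.Adj (f i) v ↔ i + 1 = m) := fun i hi => by rw [G.adj_comm, hA i hi]
  have hirr : ¬ G.Adj v v := G.irrefl
  refine ⟨fun k => if k < m then f k else v, ?_, ?_, ?_⟩
  · intro i hi j hj h
    dsimp only at h
    split_ifs at h with a b b
    · exact h1 _ a _ b h
    · exact absurd (h ▸ hT i a) hv
    · exact absurd (h ▸ hT j b) hv
    · omega
  · intro x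
    rw [Finset.mem_insert, h2]
    constructor
    · rintro (rfl | ⟨i, hi, rfl⟩)
      · exact ⟨m, by omega, by simp⟩
      · exact ⟨i, by omega, by simp [hi]⟩
    · rintro ⟨i, hi, rfl⟩
      by_cases a : i < m
      · right; exact ⟨i, a, by simp [a]⟩
      · left; simp [a]
  · intro i hi j hj
    dsimp only
    split_ifs with a b b
    · exact h3 _ a _ b
    · rw [hA' _ a]; omega
    · rw [hA _ b]; omega
    · simp only [hirr, false_iff]; omega

lemma equality {G : SimpleGraph V} (h : G.IsAcyclic) (n : ℕ) : ∀ S : Finset V, S.card = n →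
    I G S = Nat.fib (n + 2) → (0 < n → ∃ f, P G f n S) ∧ (0 < n → E G S + 2 = 2 * n) := by
  induction n using Nat.strong_induction_on with
  | _ n ih =>
    intro S hS hI
    rcases S.eq_empty_or_nonempty with rfl | hne
    · simp at hS; subst hS
      exact ⟨fun a => absurd a (lt_irrefl 0), fun a => absurd a (lt_irrefl 0)⟩
    obtain ⟨v, hv, hc⟩ := exists_leaf' h hne
    have hpos := Finset.card_pos.2 hne
    have hce := Finset.card_erase_of_mem hv
    rw [I_rec G hv] at hI
    obtain ⟨m, rfl⟩ : ∃ m, n = m + 1 := ⟨n - 1, by omega⟩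
    have h1 := lower h m (S.erase v) (by omega)
    have hf : Nat.fib (m + 1 + 2) = Nat.fib (m + 1) + Nat.fib (m + 2) := Nat.fib_add_two
    have hE := E_rec G hv
    rw [N_erase] at hE
    rcases hc with hc | ⟨u, hu, huv, hc⟩
    · rw [hc, Finset.sdiff_empty] at hI
      have hf2 : Nat.fib (m + 2) = Nat.fib m + Nat.fib (m + 1) := Nat.fib_add_two
      have hm : m = 0 := by
        have : Nat.fib m = 0 := by omega
        simpa using this
      subst hm
      have he : S.erase v = ∅ := Finset.card_eq_zero.1 (by omega)
      have hSv : S = {v} := by rw [← Finset.insert_erase hv, he]; rfl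
      refine ⟨fun _ => ⟨fun _ => v, by omega, ?_, ?_⟩, ?_⟩
      · intro x
        rw [hSv]
        simp [eq_comm]
      · intro i hi j hj
        simp; omega
      · intro _
        rw [hE, hc, he]; simp [E]
    · rw [hc, Finset.sdiff_singleton_eq_erase] at hI
      have hue : u ∈ S.erase v := Finset.mem_erase.2 ⟨huv, hu⟩
      have hce2 := Finset.card_erase_of_mem hue
      have := Finset.card_pos.2 ⟨u, hue⟩
      obtain ⟨k, rfl⟩ : ∃ k, m = k + 1 := ⟨m - 1, by omega⟩
      have h2 := lower h k ((S.erase v).erase u) (by omega)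
      have hf : Nat.fib (k + 1 + 1 + 2) = Nat.fib (k + 2) + Nat.fib (k + 1 + 2) := Nat.fib_add_two
      obtain ⟨hP, hE1⟩ := ih (k + 1) (by omega) (S.erase v) (by omega) (by omega)
      obtain ⟨-, hE2⟩ := ih k (by omega) ((S.erase v).erase u) (by omega) (by omega)
      have hE3 := E_rec G hue
      rw [N_erase] at hE3
      have hE1 := hE1 (by omega)
      have hd : (N G (S.erase v) u).card ≤ 1 := by
        rcases Nat.eq_zero_or_pos k with rfl | hk
        · omega
        · have := hE2 hk
          omega
      obtain ⟨f, hP⟩ := hP (by omega)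
      obtain ⟨g, hg⟩ := extend hP hue hd (Finset.notMem_erase v S) (by
        intro x hx
        have : x ∈ N G S v ↔ x = u := by rw [hc]; simp
        rw [← this, N, Finset.mem_filter]
        exact ⟨fun a => ⟨Finset.mem_of_mem_erase hx, a⟩, fun a => a.2⟩)
      rw [Finset.insert_erase hv] at hg
      refine ⟨fun _ => ⟨g, hg⟩, fun _ => ?_⟩
      rw [hE, hc, Finset.card_singleton]
      omega

lemma path_iso {G : SimpleGraph V} {n : ℕ} {f : ℕ → V} (hP : P G f n Finset.univ) :
    Nonempty (G ≃g SimpleGraph.pathGraph n) := by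
  obtain ⟨h1, h2, h3⟩ := hP
  have hb : Function.Bijective (fun i : Fin n => f i) := by
    constructor
    · intro i j hij
      exact Fin.ext (h1 _ i.2 _ j.2 hij)
    · intro x
      obtain ⟨i, hi, h⟩ := (h2 x).1 (Finset.mem_univ _)
      exact ⟨⟨i, hi⟩, h⟩
  refine ⟨SimpleGraph.Iso.symm ⟨Equiv.ofBijective _ hb, ?_⟩⟩
  intro i j
  rw [SimpleGraph.pathGraph_adj]
  exact h3 _ i.2 _ j.2

lemma iso_path {G : SimpleGraph V} {n : ℕ} (x : V) (e : G ≃g SimpleGraph.pathGraph n) :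
    ∃ f, P G f n Finset.univ := by
  refine ⟨fun i => if h : i < n then e.symm ⟨i, h⟩ else x, ?_, ?_, ?_⟩
  · intro i hi j hj h
    simpa [hi, hj] using h
  · intro y
    simp only [Finset.mem_univ, true_iff]
    exact ⟨e y, (e y).2, by simp⟩
  · intro i hi j hj
    simp only [hi, hj, dif_pos]
    rw [e.symm.map_adj_iff, SimpleGraph.pathGraph_adj]

end FibTree

theorem stmt_8 {V : Type*} [Fintype V] (G : SimpleGraph V) (n : ℕ)
    (hn : n = Fintype.card V) (hG : G.IsTree) :
    Nat.fib (n + 2) ≤ fibIndex G ∧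
      (fibIndex G = Nat.fib (n + 2) ↔ Nonempty (G ≃g SimpleGraph.pathGraph n)) := by
  have hI : fibIndex G = FibTree.I G Finset.univ := by
    unfold fibIndex FibTree.I
    rw [Finset.powerset_univ]
  have hc : (Finset.univ : Finset V).card = n := by rw [hn, Finset.card_univ]
  have hac := hG.isAcyclic
  obtain ⟨x⟩ := hG.connected.nonempty
  have hn0 : n ≠ 0 := by
    rw [← hc]
    exact (Finset.card_pos.2 ⟨x, Finset.mem_univ x⟩).ne'
  rw [hI]
  refine ⟨FibTree.lower hac n _ hc, ?_, ?_⟩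
  · intro h
    obtain ⟨f, hf⟩ := (FibTree.equality hac n _ hc h).1 (Nat.pos_of_ne_zero hn0)
    exact FibTree.path_iso hf
  · rintro ⟨e⟩
    obtain ⟨f, hf⟩ := FibTree.iso_path x e
    exact FibTree.path_I n f _ hf
end

section
/- For every graph G on n vertices with independence number α, F(G) ≥ 2^α + n − α, with equality if and only if G is the complete split graph CS_{n,α}. -/
open Finset
open scoped Classical

/-- The complete split graph `CS_{n,α}` on `Fin n`: the first `α` vertices form an
independent set, the remaining `n - α` vertices form a clique, and every vertex of
the independent set is adjacent to every vertex of the clique. -/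
def completeSplitGraph (n α : ℕ) : SimpleGraph (Fin n) :=
  SimpleGraph.fromRel (fun a _ => α ≤ (a : ℕ))

theorem aux_split {V : Type*} [Fintype V] (G : SimpleGraph V) (S : Finset V)
    (hS : ∀ a ∈ S, ∀ b ∈ S, ¬ G.Adj a b) :
    2 ^ S.card + Fintype.card V - S.card ≤ fibIndex G ∧
      (fibIndex G = 2 ^ S.card + Fintype.card V - S.card ↔
        ∀ a b, G.Adj a b ↔ a ≠ b ∧ (a ∉ S ∨ b ∉ S)) := by
  set T : Finset (Finset V) := S.powerset ∪ Sᶜ.image (fun v => {v}) with hT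
  have hcard : T.card = 2 ^ S.card + Fintype.card V - S.card := by
    rw [hT, Finset.card_union_of_disjoint, Finset.card_powerset, Finset.card_image_of_injective,
      Finset.card_compl, Nat.add_sub_assoc (Finset.card_le_univ S)]
    · exact Finset.singleton_injective
    · rw [Finset.disjoint_left]
      intro s hs hs'
      simp only [Finset.mem_image, Finset.mem_compl] at hs'
      obtain ⟨v, hv, rfl⟩ := hs'
      simp at hs
      exact hv hs
  have hsub : T ⊆ Finset.univ.filter fun s : Finset V => ∀ a ∈ s, ∀ b ∈ s, ¬ G.Adj a b := by
    intro s hs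
    simp only [Finset.mem_filter, Finset.mem_univ, true_and]
    rw [hT, Finset.mem_union] at hs
    rcases hs with hs | hs
    · rw [Finset.mem_powerset] at hs
      exact fun a ha b hb => hS a (hs ha) b (hs hb)
    · simp only [Finset.mem_image] at hs
      obtain ⟨v, hv, rfl⟩ := hs
      simp
  rw [← hcard]
  refine ⟨Finset.card_le_card hsub, ?_, ?_⟩
  · intro h
    have hE := Finset.eq_of_subset_of_card_le hsub h.le
    have key : ∀ a b, a ≠ b → a ∉ S → G.Adj a b := by
      intro a b hab ha
      by_contra hn
      have hm : ({a, b} : Finset V) ∈ T := by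
        rw [hE]
        simp [hn, G.adj_comm b a]
      rw [hT, Finset.mem_union] at hm
      rcases hm with hm | hm
      · rw [Finset.mem_powerset] at hm
        exact ha (hm (by simp))
      · simp only [Finset.mem_image] at hm
        obtain ⟨v, -, hv⟩ := hm
        have h1 : a ∈ ({v} : Finset V) := by rw [hv]; simp
        have h2 : b ∈ ({v} : Finset V) := by rw [hv]; simp
        simp at h1 h2
        exact hab (h1.trans h2.symm)
    intro a b
    constructor
    · intro hab
      refine ⟨hab.ne, ?_⟩
      by_contra hc
      push Not at hc
      exact hS a hc.1 b hc.2 hab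
    · rintro ⟨hab, h | h⟩
      · exact key a b hab h
      · exact (key b a hab.symm h).symm
  · intro h
    refine congrArg Finset.card (Finset.Subset.antisymm ?_ hsub)
    intro s hs
    simp only [Finset.mem_filter, Finset.mem_univ, true_and] at hs
    rw [hT, Finset.mem_union]
    by_cases hsS : s ⊆ S
    · exact Or.inl (Finset.mem_powerset.2 hsS)
    · right
      rw [Finset.not_subset] at hsS
      obtain ⟨a, ha, haS⟩ := hsS
      simp only [Finset.mem_image, Finset.mem_compl]
      refine ⟨a, haS, ?_⟩
      ext b
      rw [Finset.mem_singleton]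
      constructor
      · rintro rfl
        exact ha
      · intro hb
        by_contra hne
        exact hs a ha b hb ((h a b).2 ⟨fun e => hne e.symm, Or.inl haS⟩)

theorem aux_adj (n α : ℕ) (a b : Fin n) :
    (completeSplitGraph n α).Adj a b ↔ a ≠ b ∧ (α ≤ (a : ℕ) ∨ α ≤ (b : ℕ)) := by
  simp [completeSplitGraph, SimpleGraph.fromRel_adj]

theorem aux_card (n α : ℕ) (h : α ≤ n) :
    (Finset.univ.filter fun i : Fin n => (i : ℕ) < α).card = α := by
  rw [Fin.card_filter_val_lt]
  exact min_eq_right h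

theorem stmt_9 {V : Type*} [Fintype V] (G : SimpleGraph V) (n α : ℕ)
    (hn : n = Fintype.card V) (hα : α = indepNum G) :
    2 ^ α + n - α ≤ fibIndex G ∧
      (fibIndex G = 2 ^ α + n - α ↔ Nonempty (G ≃g completeSplitGraph n α)) := by
  obtain ⟨S, hSm, hSc⟩ := Finset.exists_mem_eq_sup
    (Finset.univ.filter fun s : Finset V => ∀ a ∈ s, ∀ b ∈ s, ¬ G.Adj a b)
    ⟨∅, by simp⟩ Finset.card
  have hc : S.card = α := by rw [hα, indepNum, hSc]
  simp only [Finset.mem_filter, Finset.mem_univ, true_and] at hSm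
  have hle : α ≤ n := by rw [← hc, hn]; exact Finset.card_le_univ S
  have h1 := aux_split G S hSm
  rw [hc, ← hn] at h1
  refine ⟨h1.1, ?_, ?_⟩
  · intro h
    have hadj := h1.2.1 h
    let e0 : V ≃ Fin n := Fintype.equivFinOfCardEq hn.symm
    have hcc : Fintype.card {i : Fin n // e0.symm i ∈ S} =
        Fintype.card {i : Fin n // (i : ℕ) < α} := by
      rw [Fintype.card_subtype, Fintype.card_subtype, aux_card n α hle, ← hc]
      refine Finset.card_bij (fun i _ => e0.symm i) ?_ ?_ ?_
      · intro i hi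
        simpa using hi
      · intro i _ j _ hij
        exact e0.symm.injective hij
      · intro v hv
        exact ⟨e0 v, by simpa using hv, by simp⟩
    let e1 := Fintype.equivOfCardEq hcc
    let e : V ≃ Fin n := e0.trans e1.extendSubtype
    have he : ∀ v, v ∉ S ↔ α ≤ (e v : ℕ) := by
      intro v
      constructor
      · intro hv
        have := e1.extendSubtype_not_mem (e0 v) (by simpa using hv)
        exact not_lt.1 this
      · intro hv hvS
        have := e1.extendSubtype_mem (e0 v) (by simpa using hvS)
        exact absurd this (not_lt.2 hv)
    refine ⟨⟨e, ?_⟩⟩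
    intro a b
    rw [aux_adj, hadj, he, he, e.injective.ne_iff]
  · rintro ⟨φ⟩
    let S' : Finset V := Finset.univ.filter fun v => (φ v : ℕ) < α
    have hS' : S'.card = α := by
      rw [← aux_card n α hle]
      refine Finset.card_bij (fun v _ => φ v) ?_ ?_ ?_
      · intro i hi
        simpa [S'] using hi
      · intro i _ j _ hij
        exact φ.injective hij
      · intro v hv
        exact ⟨φ.symm v, by simpa [S'] using hv, by simp⟩
    have hadj : ∀ a b, G.Adj a b ↔ a ≠ b ∧ (a ∉ S' ∨ b ∉ S') := by
      intro a b
      rw [← φ.map_adj_iff, aux_adj, φ.injective.ne_iff]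
      simp [S']
    have h2 := aux_split G S' (by
      intro a ha b hb hab
      rcases ((hadj a b).1 hab).2 with h | h
      · exact h ha
      · exact h hb)
    rw [hS', ← hn] at h2
    exact h2.2.2 hadj
end

section
/- Let G be a graph on n vertices with independence number α. Then F(G) ≤ (⌈n/α⌉ + 1)^p · (⌊n/α⌋ + 1)^{α − p}, where p = n mod α, with equality if and only if G is isomorphic to the Turán graph T(n, α) (the disjoint union of α balanced cliques). -/
open Finset
open scoped Classical

/-- The Turán graph `T(n, α)`: the disjoint union of `α` balanced cliques on `n`
vertices (vertices are grouped into cliques by their residue modulo `α`; this is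
the complement of Mathlib's complete multipartite `turanGraph`). -/
def turanUnionOfCliques (n α : ℕ) : SimpleGraph (Fin n) :=
  (SimpleGraph.turanGraph n α)ᶜ

/-- `f_T(n, α) = (⌈n/α⌉ + 1)^p * (⌊n/α⌋ + 1)^(α - p)` with `p = n % α`,
the Fibonacci index of the Turán graph `T(n, α)`. -/
def fT (n α : ℕ) : ℕ :=
  ((n + α - 1) / α + 1) ^ (n % α) * (n / α + 1) ^ (α - n % α)

theorem fT_eq (q r a : ℕ) (h : r ≤ a) :
    fT (q * a + r) a = (q + 2) ^ r * (q + 1) ^ (a - r) := by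
  rcases Nat.eq_zero_or_pos a with rfl | ha
  · obtain rfl : r = 0 := by omega
    simp [fT]
  rcases h.lt_or_eq with h | rfl
  · have h1 : (q * a + r) % a = r := by
      rw [Nat.mul_add_mod_self_right, Nat.mod_eq_of_lt h]
    have h2 : (q * a + r) / a = q := by
      rw [Nat.mul_comm, Nat.mul_add_div ha, Nat.div_eq_of_lt h, Nat.add_zero]
    unfold fT
    rw [h1, h2]
    rcases Nat.eq_zero_or_pos r with rfl | hr
    · simp
    · have h3 : (q * a + r + a - 1) / a = q + 1 := by
        have : q * a + r + a - 1 = a * (q + 1) + (r - 1) := by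
          have : a * (q + 1) = q * a + a := by ring
          omega
        rw [this, Nat.mul_add_div ha, Nat.div_eq_of_lt (by omega), Nat.add_zero]
      rw [h3]
  · have h0 : q * r + r = r * (q + 1) := by ring
    have h1 : (q * r + r) % r = 0 := by rw [h0]; simp
    have h2 : (q * r + r) / r = q + 1 := by rw [h0]; exact Nat.mul_div_cancel_left _ ha
    unfold fT
    rw [h1, h2]
    simp

theorem fT_pos (n a : ℕ) : 0 < fT n a := by
  unfold fT; positivity

theorem fT_rec (m a : ℕ) :
    fT (m + 1) (a + 1) = fT m (a + 1) + fT (m - m / (a + 1)) a := by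
  obtain ⟨q, hq⟩ : ∃ q, q = m / (a + 1) := ⟨_, rfl⟩
  obtain ⟨r, hr⟩ : ∃ r, r = m % (a + 1) := ⟨_, rfl⟩
  have hra : r ≤ a := by
    have := Nat.mod_lt m (Nat.succ_pos a)
    simp only [Nat.succ_eq_add_one] at this
    omega
  have hm : m = q * (a + 1) + r := by
    rw [hq, hr, Nat.mul_comm]; exact (Nat.div_add_mod m (a + 1)).symm
  have h2 : m - m / (a + 1) = q * a + r := by
    rw [← hq, hm]
    have : q * (a + 1) = q * a + q := by ring
    omega
  rw [h2, hm, Nat.add_assoc, fT_eq q (r + 1) (a + 1) (by omega), fT_eq q r (a + 1) (by omega),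
    fT_eq q r a hra]
  have h3 : a + 1 - r = (a - r) + 1 := by omega
  have h4 : a + 1 - (r + 1) = a - r := by omega
  rw [h3, h4]
  ring

theorem fT_strictMono (a : ℕ) : StrictMono fun n => fT n (a + 1) := by
  apply strictMono_nat_of_lt_succ
  intro n
  have := fT_rec n a
  have := fT_pos (n - n / (a + 1)) a
  omega

theorem fT_mono (a : ℕ) : Monotone fun n => fT n a := by
  cases a with
  | zero =>
    intro m n _
    simp [fT]
  | succ a => exact (fT_strictMono a).monotone

/-- independent finset -/
def Ind {V : Type*} (G : SimpleGraph V) (s : Finset V) : Prop := ∀ a ∈ s, ∀ b ∈ s, ¬ G.Adj a b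

noncomputable def FF {V : Type*} (G : SimpleGraph V) (S : Finset V) : ℕ :=
  #{s ∈ S.powerset | Ind G s}

/-- balanced clique colouring -/
def Bal {V : Type*} (G : SimpleGraph V) (S : Finset V) (a : ℕ) (c : V → ℕ) : Prop :=
  (∀ x ∈ S, c x < a) ∧ (∀ x ∈ S, ∀ y ∈ S, G.Adj x y ↔ x ≠ y ∧ c x = c y) ∧
    ∀ i < a, ∀ j < a, #{x ∈ S | c x = i} ≤ #{x ∈ S | c x = j} + 1

theorem Ind.insert' {V : Type*} {G : SimpleGraph V} {s : Finset V} (hs : Ind G s) {v : V}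
    (h : ∀ x ∈ s, ¬ G.Adj v x) : Ind G (insert v s) := by
  intro a ha b hb
  rw [Finset.mem_insert] at ha hb
  rcases ha with rfl | ha <;> rcases hb with rfl | hb
  · exact G.loopless.irrefl _
  · exact h b hb
  · exact fun hab => h a ha hab.symm
  · exact hs a ha b hb

theorem FF_rec {V : Type*} (G : SimpleGraph V) (S : Finset V) (v : V) (hv : v ∈ S) :
    FF G S = FF G (S.erase v) + FF G {x ∈ S.erase v | ¬ G.Adj v x} := by
  unfold FF
  rw [← Finset.card_filter_add_card_filter_not (s := {s ∈ S.powerset | Ind G s}) (fun s => v ∉ s)]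
  congr 1
  · congr 1
    ext s
    simp only [Finset.mem_filter, Finset.mem_powerset, Finset.subset_erase]
    tauto
  · symm
    apply Finset.card_bij (fun s _ => insert v s)
    · intro s hs
      simp only [Finset.mem_filter, Finset.mem_powerset] at hs ⊢
      refine ⟨⟨?_, ?_⟩, by simp⟩
      · intro x hx
        rcases Finset.mem_insert.1 hx with rfl | hx
        · exact hv
        · have := hs.1 hx
          simp at this
          exact this.1.2
      · apply hs.2.insert'
        intro x hx
        exact (Finset.mem_filter.1 (hs.1 hx)).2
    · intro s hs t ht h
      simp only [Finset.mem_filter, Finset.mem_powerset] at hs ht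
      have h1 : v ∉ s := fun h => by simpa using hs.1 h
      have h2 : v ∉ t := fun h => by simpa using ht.1 h
      rw [← Finset.erase_insert h1, h, Finset.erase_insert h2]
    · intro t ht
      simp only [Finset.mem_filter, Finset.mem_powerset, not_not] at ht
      refine ⟨t.erase v, ?_, Finset.insert_erase ht.2⟩
      simp only [Finset.mem_filter, Finset.mem_powerset]
      refine ⟨?_, ?_⟩
      · intro x hx
        rw [Finset.mem_erase] at hx
        simp only [Finset.mem_filter, Finset.mem_erase]
        exact ⟨⟨hx.1, ht.1.1 hx.2⟩, ht.1.2 v ht.2 x hx.2⟩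
      · intro x hx y hy
        exact ht.1.2 x (Finset.mem_of_mem_erase hx) y (Finset.mem_of_mem_erase hy)

theorem greedy {V : Type*} (G : SimpleGraph V) (S : Finset V) (a q : ℕ)
    (hS : ∀ s ⊆ S, Ind G s → #s ≤ a) (hd : ∀ v ∈ S, #{x ∈ S | G.Adj v x} + 1 ≤ q) :
    #S ≤ a * q := by
  obtain ⟨s, hs, hmax⟩ := Finset.exists_max_image ({s ∈ S.powerset | Ind G s}) Finset.card
    ⟨∅, Finset.mem_filter.2 ⟨by simp, by simp [Ind]⟩⟩
  simp only [Finset.mem_filter, Finset.mem_powerset] at hs hmax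
  have hsub : S ⊆ s.biUnion fun v => insert v {x ∈ S | G.Adj v x} := by
    intro x hx
    by_contra hcon
    simp only [Finset.mem_biUnion, Finset.mem_insert, Finset.mem_filter, not_exists, not_and,
      not_or] at hcon
    have hxs : x ∉ s := fun h => (hcon x h).1 rfl
    have := hmax (insert x s) ⟨Finset.insert_subset hx hs.1,
      hs.2.insert' fun y hy hxy => (hcon y hy).2 hx hxy.symm⟩
    rw [Finset.card_insert_of_notMem hxs] at this
    omega
  refine (Finset.card_le_card hsub).trans ((Finset.card_biUnion_le_card_mul _ _ q ?_).trans ?_)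
  · intro v hv
    exact (Finset.card_insert_le _ _).trans (hd v (hs.1 hv))
  · exact Nat.mul_le_mul_right _ (hS s hs.1 hs.2)

theorem sum_fib {V : Type*} (S : Finset V) (a : ℕ) (c : V → ℕ) (h : ∀ x ∈ S, c x < a) :
    ∑ i ∈ range a, #{x ∈ S | c x = i} = #S :=
  (Finset.card_eq_sum_card_fiberwise (fun x hx => by simpa using h x hx)).symm

theorem bal_min {V : Type*} {G : SimpleGraph V} {S : Finset V} {a : ℕ} {c : V → ℕ}
    (h : Bal G S a c) (i : ℕ) (hi : i < a) : #S / a ≤ #{x ∈ S | c x = i} := by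
  by_contra hcon
  push Not at hcon
  have h1 : ∑ i ∈ range a, #{x ∈ S | c x = i} < ∑ i ∈ range a, #S / a := by
    apply Finset.sum_lt_sum
    · intro j hj
      have := h.2.2 j (by simpa using hj) i hi
      omega
    · exact ⟨i, by simpa using hi, hcon⟩
  rw [sum_fib S a c h.1] at h1
  simp only [sum_const, card_range, smul_eq_mul] at h1
  have := Nat.mul_div_le #S a
  omega

theorem main_aux {V : Type*} (G : SimpleGraph V) (S : Finset V) : ∀ a : ℕ,
    (∀ s ⊆ S, Ind G s → #s ≤ a) →
    FF G S ≤ fT #S a ∧ (FF G S = fT #S a → ∃ c, Bal G S a c) := by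
  induction S using Finset.strongInduction with
  | H S ih =>
  intro a hS
  rcases S.eq_empty_or_nonempty with rfl | hne
  · have h1 : FF G (∅ : Finset V) = 1 := by
      unfold FF
      rw [Finset.filter_true_of_mem]
      · simp
      · intro s hs
        obtain rfl : s = ∅ := by simpa using hs
        simp [Ind]
    have := fT_pos 0 a
    exact ⟨by rw [h1]; exact this, fun _ => ⟨fun _ => 0, by simp [Bal]⟩⟩
  obtain ⟨a, rfl⟩ : ∃ b, a = b + 1 := by
    obtain ⟨x, hx⟩ := hne
    have := hS {x} (by simpa using hx) (by simp [Ind])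
    simp at this
    exact ⟨a - 1, by omega⟩
  obtain ⟨m, hm⟩ : ∃ m, #S = m + 1 := ⟨#S - 1, by have := hne.card_pos; omega⟩
  obtain ⟨q, hq⟩ : ∃ q, q = m / (a + 1) := ⟨_, rfl⟩
  obtain ⟨v, hv, hvd⟩ : ∃ v ∈ S, q ≤ #{x ∈ S | G.Adj v x} := by
    by_contra hcon
    push Not at hcon
    have := greedy G S (a + 1) q hS hcon
    have := Nat.mul_div_le m (a + 1)
    rw [← hq] at this
    omega
  have hem : #(S.erase v) = m := by rw [Finset.card_erase_of_mem hv]; omega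
  have hN : ({x ∈ S | G.Adj v x} : Finset V) = {x ∈ S.erase v | G.Adj v x} := by
    ext x
    simp only [Finset.mem_filter, Finset.mem_erase]
    exact ⟨fun h => ⟨⟨h.2.ne', h.1⟩, h.2⟩, fun h => ⟨h.1.2, h.2⟩⟩
  rw [hN] at hvd
  have hsplit := Finset.card_filter_add_card_filter_not (s := S.erase v) (fun x => G.Adj v x)
  rw [hem] at hsplit
  set N := {x ∈ S.erase v | G.Adj v x} with hNdef
  set S2 := {x ∈ S.erase v | ¬ G.Adj v x} with hS2
  have hss : S.erase v ⊂ S := Finset.erase_ssubset hv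
  have hS2s : S2 ⊆ S.erase v := Finset.filter_subset _ _
  obtain ⟨i1, i1'⟩ := ih (S.erase v) hss (a + 1) fun s hs hi => hS s (hs.trans hss.1) hi
  obtain ⟨i2, -⟩ := ih S2 (Finset.ssubset_of_subset_of_ssubset hS2s hss) a fun s hs hi => by
    have hvs : v ∉ s := fun h => by simpa using hS2s (hs h)
    have := hS (insert v s) (Finset.insert_subset hv ((hs.trans hS2s).trans hss.1))
      (hi.insert' fun x hx => (Finset.mem_filter.1 (hs hx)).2)
    rw [Finset.card_insert_of_notMem hvs] at this
    omega
  have hrec := FF_rec G S v hv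
  rw [← hS2] at hrec
  have hfrec := fT_rec m a
  rw [← hq] at hfrec
  have hle : #S2 ≤ m - q := by omega
  have i3 := fT_mono a hle
  simp only at i3
  rw [hem] at i1 i1'
  rw [hm, hfrec, hrec]
  refine ⟨by omega, fun heq => ?_⟩
  obtain ⟨c, hc⟩ := i1' (by omega)
  have hcard : #N = q := by
    have : fT #S2 a = fT (m - q) a := by omega
    have hqm : q ≤ m := by rw [hq]; exact Nat.div_le_self _ _
    cases a with
    | zero => simp at hq; omega
    | succ a =>
      have := (fT_strictMono a).injective this
      omega
  obtain ⟨i, hi, hiN⟩ : ∃ i < a + 1, ∀ x ∈ S.erase v, c x = i → G.Adj v x := by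
    by_contra hcon
    push Not at hcon
    have : Nonempty V := ⟨v⟩
    choose! f hf1 hf2 hf3 using hcon
    have hinj : Set.InjOn f ((range (a + 1) : Finset ℕ) : Set ℕ) := by
      intro i hi j hj hij
      have hi := Finset.mem_range.1 (Finset.mem_coe.1 hi)
      have hj := Finset.mem_range.1 (Finset.mem_coe.1 hj)
      rw [← hf2 i hi, ← hf2 j hj, hij]
    have hvs : v ∉ (range (a + 1)).image f := by
      intro h
      obtain ⟨i, hi, h⟩ := Finset.mem_image.1 h
      have := hf1 i (by simpa using hi)
      rw [h] at this
      simp at this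
    have := hS (insert v ((range (a + 1)).image f)) ?_ ?_
    · rw [Finset.card_insert_of_notMem hvs, Finset.card_image_of_injOn hinj] at this
      simp at this
    · apply Finset.insert_subset hv
      intro x hx
      obtain ⟨i, hi, rfl⟩ := Finset.mem_image.1 hx
      exact hss.1 (hf1 i (by simpa using hi))
    · apply Ind.insert'
      · intro x hx y hy hxy
        obtain ⟨i, hi, rfl⟩ := Finset.mem_image.1 hx
        obtain ⟨j, hj, rfl⟩ := Finset.mem_image.1 hy
        have hi := Finset.mem_range.1 hi
        have hj := Finset.mem_range.1 hj
        obtain ⟨h1, h2⟩ := (hc.2.1 _ (hf1 i hi) _ (hf1 j hj)).1 hxy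
        rw [hf2 i hi, hf2 j hj] at h2
        exact h1 (by rw [h2])
      · intro x hx
        obtain ⟨i, hi, rfl⟩ := Finset.mem_image.1 hx
        exact hf3 i (by simpa using hi)
  have hmin := bal_min hc
  rw [hem, ← hq] at hmin
  have hfN : ({x ∈ S.erase v | c x = i} : Finset V) = N := by
    apply Finset.eq_of_subset_of_card_le
    · intro x hx
      rw [Finset.mem_filter] at hx
      exact Finset.mem_filter.2 ⟨hx.1, hiN x hx.1 hx.2⟩
    · rw [hcard]; exact hmin i hi
  have hadj : ∀ x ∈ S, x ≠ v → (G.Adj v x ↔ c x = i) := by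
    intro x hx hxv
    have := Finset.ext_iff.1 hfN x
    simp only [hNdef, Finset.mem_filter, Finset.mem_erase] at this
    tauto
  have hfib1 : #{x ∈ S | Function.update c v i x = i} = q + 1 := by
    have : ({x ∈ S | Function.update c v i x = i} : Finset V) = insert v N := by
      rw [← hfN]
      ext x
      simp only [Finset.mem_filter, Finset.mem_insert, Finset.mem_erase]
      by_cases hxv : x = v
      · subst hxv; simp [hv]
      · simp [hxv]
    rw [this, Finset.card_insert_of_notMem (by simp [hNdef]), hcard]
  have hfib2 : ∀ j, j ≠ i → #{x ∈ S | Function.update c v i x = j} = #{x ∈ S.erase v | c x = j} := by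
    intro j hj
    congr 1
    ext x
    simp only [Finset.mem_filter, Finset.mem_erase]
    by_cases hxv : x = v
    · subst hxv; simp [hj.symm]
    · simp [hxv]
  refine ⟨Function.update c v i, ?_, ?_, ?_⟩
  · intro x hx
    by_cases hxv : x = v
    · subst hxv; simpa using hi
    · simpa [hxv] using hc.1 x (by simp [hx, hxv])
  · intro x hx y hy
    by_cases hxv : x = v <;> by_cases hyv : y = v
    · subst hxv; subst hyv; simp
    · subst hxv
      rw [hadj y hy hyv]
      simp [hyv, Ne.symm hyv, eq_comm]
    · subst hyv
      rw [G.adj_comm, hadj x hx hxv]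
      simp [hxv]
    · rw [hc.2.1 x (by simp [hx, hxv]) y (by simp [hy, hyv])]
      simp [hxv, hyv]
  · intro j hj k hk
    have hki := hc.2.2 j hj i hi
    rw [hfN, hcard] at hki
    have := hc.2.2 j hj k hk
    have := hmin k hk
    by_cases hji : j = i <;> by_cases hki : k = i
    · subst hji; subst hki; omega
    · subst hji; rw [hfib1, hfib2 k hki]; omega
    · subst hki; rw [hfib1, hfib2 j hji]; omega
    · rw [hfib2 j hji, hfib2 k hki]; omega

theorem FF_prod {V : Type*} (G : SimpleGraph V) (S : Finset V) (a : ℕ) (c : V → ℕ)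
    (h : Bal G S a c) : FF G S = ∏ i : Fin a, (#{x ∈ S | c x = i} + 1) := by
  have key : ∀ i : Fin a, #{x ∈ S | c x = i} + 1 =
      #{t ∈ ({x ∈ S | c x = i} : Finset V).powerset | #t ≤ 1} := by
    intro i
    set T : Finset V := {x ∈ S | c x = i}
    have : ({t ∈ T.powerset | #t ≤ 1} : Finset (Finset V)) =
        T.powersetCard 0 ∪ T.powersetCard 1 := by
      ext t
      simp only [Finset.mem_filter, Finset.mem_powerset, Finset.mem_union,
        Finset.mem_powersetCard, ← and_or_left]
      exact and_congr_right fun _ => by omega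
    rw [this, Finset.card_union_of_disjoint]
    · simp [Nat.add_comm]
    · exact Finset.pairwise_disjoint_powersetCard _ (by simp)
  rw [Finset.prod_congr rfl fun i _ => key i, ← Fintype.card_piFinset, FF]
  apply Finset.card_bij' (fun s _ => fun i : Fin a => ({x ∈ s | c x = i} : Finset V))
    (fun f _ => Finset.univ.biUnion f)
  · intro s hs
    simp only [Finset.mem_filter, Finset.mem_powerset] at hs
    simp only [Fintype.mem_piFinset, Finset.mem_filter, Finset.mem_powerset]
    intro i
    refine ⟨Finset.filter_subset_filter _ hs.1, Finset.card_le_one.2 ?_⟩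
    intro x hx y hy
    rw [Finset.mem_filter] at hx hy
    by_contra hxy
    exact hs.2 x hx.1 y hy.1
      ((h.2.1 x (hs.1 hx.1) y (hs.1 hy.1)).2 ⟨hxy, hx.2.trans hy.2.symm⟩)
  · intro f hf
    simp only [Fintype.mem_piFinset, Finset.mem_filter, Finset.mem_powerset] at hf
    simp only [Finset.mem_filter, Finset.mem_powerset]
    have hsub : Finset.univ.biUnion f ⊆ S := by
      intro x hx
      obtain ⟨i, -, hx⟩ := Finset.mem_biUnion.1 hx
      exact (Finset.mem_filter.1 ((hf i).1 hx)).1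
    refine ⟨hsub, ?_⟩
    intro x hx y hy hxy
    obtain ⟨hne, hcc⟩ := (h.2.1 x (hsub hx) y (hsub hy)).1 hxy
    obtain ⟨i, -, hx⟩ := Finset.mem_biUnion.1 hx
    obtain ⟨j, -, hy⟩ := Finset.mem_biUnion.1 hy
    have h1 := (Finset.mem_filter.1 ((hf i).1 hx)).2
    have h2 := (Finset.mem_filter.1 ((hf j).1 hy)).2
    have : i = j := Fin.ext (by omega)
    subst this
    exact hne (Finset.card_le_one.1 (hf i).2 x hx y hy)
  · intro s hs
    simp only [Finset.mem_filter, Finset.mem_powerset] at hs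
    ext x
    simp only [Finset.mem_biUnion, Finset.mem_univ, true_and, Finset.mem_filter]
    exact ⟨fun ⟨_, h, _⟩ => h, fun hx => ⟨⟨c x, h.1 x (hs.1 hx)⟩, hx, rfl⟩⟩
  · intro f hf
    simp only [Fintype.mem_piFinset, Finset.mem_filter, Finset.mem_powerset] at hf
    funext i
    ext x
    simp only [Finset.mem_biUnion, Finset.mem_univ, true_and, Finset.mem_filter]
    constructor
    · rintro ⟨⟨j, hx⟩, hi⟩
      have h1 := (Finset.mem_filter.1 ((hf j).1 hx)).2
      have : i = j := Fin.ext (by omega)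
      rwa [this]
    · intro hx
      exact ⟨⟨i, hx⟩, (Finset.mem_filter.1 ((hf i).1 hx)).2⟩

/-- fibre sizes of a balanced colouring -/
theorem bal_sizes {V : Type*} {G : SimpleGraph V} {S : Finset V} {a : ℕ} {c : V → ℕ}
    (h : Bal G S a c) : (∀ i : Fin a, #{x ∈ S | c x = i} =
      #S / a + if #{x ∈ S | c x = i} = #S / a + 1 then 1 else 0) ∧
      #{i : Fin a | #{x ∈ S | c x = i} = #S / a + 1} = #S % a := by
  have hsum := sum_fib S a c h.1
  rw [Finset.sum_range] at hsum
  have hmod := Nat.div_add_mod #S a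
  rcases Nat.eq_zero_or_pos a with rfl | ha
  · refine ⟨fun i => i.elim0, ?_⟩
    simp at hsum ⊢
    omega
  have hlt := Nat.mod_lt #S ha
  have hmin := bal_min h
  obtain ⟨i0, hi0⟩ : ∃ i0 : Fin a, #{x ∈ S | c x = i0} ≤ #S / a := by
    by_contra hcon
    push Not at hcon
    have : ∑ i : Fin a, (#S / a + 1) ≤ ∑ i : Fin a, #{x ∈ S | c x = i} :=
      Finset.sum_le_sum fun i _ => hcon i
    rw [hsum] at this
    simp [Nat.mul_add] at this
    omega
  have h1 : ∀ i : Fin a, #{x ∈ S | c x = i} =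
      #S / a + if #{x ∈ S | c x = i} = #S / a + 1 then 1 else 0 := by
    intro i
    have := hmin i i.2
    have := h.2.2 i i.2 i0 i0.2
    split_ifs <;> omega
  refine ⟨h1, ?_⟩
  rw [Finset.sum_congr rfl fun i _ => h1 i, Finset.sum_add_distrib] at hsum
  simp only [sum_const, Finset.card_univ, Fintype.card_fin, smul_eq_mul, Finset.sum_boole,
    Nat.cast_id] at hsum
  omega

theorem bal_sizes' {V : Type*} {G : SimpleGraph V} {S : Finset V} {a : ℕ} {c : V → ℕ}
    (h : Bal G S a c) (N : ℕ) (hN : #S = N) : (∀ i : Fin a, #{x ∈ S | c x = i} =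
      N / a + if #{x ∈ S | c x = i} = N / a + 1 then 1 else 0) ∧
      #{i : Fin a | #{x ∈ S | c x = i} = N / a + 1} = N % a := by
  subst hN
  exact bal_sizes h

theorem FF_bal {V : Type*} (G : SimpleGraph V) (S : Finset V) (a : ℕ) (c : V → ℕ)
    (h : Bal G S a c) : FF G S = fT #S a := by
  obtain ⟨h1, h2⟩ := bal_sizes h
  have hr : #S % a ≤ a := by
    rw [← h2]; exact (Finset.card_le_univ _).trans (by simp)
  have h3 : fT #S a = fT (#S / a * a + #S % a) a := by rw [Nat.div_add_mod']
  rw [FF_prod G S a c h, h3, fT_eq _ _ _ hr]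
  have h4 : ∀ i : Fin a, #{x ∈ S | c x = i} + 1 =
      if #{x ∈ S | c x = i} = #S / a + 1 then #S / a + 2 else #S / a + 1 := by
    intro i
    have := h1 i
    split_ifs at this ⊢ <;> omega
  rw [Finset.prod_congr rfl fun i _ => h4 i, Finset.prod_ite, Finset.prod_const, Finset.prod_const,
    h2]
  congr 2
  have := Finset.card_filter_add_card_filter_not (s := (Finset.univ : Finset (Fin a)))
    (fun i : Fin a => #{x ∈ S | c x = i} = #S / a + 1)
  rw [h2] at this
  simp only [Finset.card_univ, Fintype.card_fin] at this
  omega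

theorem bal_iso {V W : Type*} [Fintype V] [Fintype W] (G : SimpleGraph V) (H : SimpleGraph W)
    (a : ℕ) (c : V → ℕ) (d : W → ℕ) (hc : Bal G univ a c) (hd : Bal H univ a d)
    (hcard : Fintype.card V = Fintype.card W) : Nonempty (G ≃g H) := by
  obtain ⟨h1, h2⟩ := bal_sizes' hc (Fintype.card V) Finset.card_univ
  obtain ⟨h3, h4⟩ := bal_sizes' hd (Fintype.card V) (Finset.card_univ.trans hcard.symm)
  have e0 : {i : Fin a // #{x | c x = i} = Fintype.card V / a + 1} ≃
      {i : Fin a // #{x | d x = i} = Fintype.card V / a + 1} := by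
    apply Fintype.equivOfCardEq
    rw [Fintype.card_subtype, Fintype.card_subtype, h2, h4]
  let σ : Equiv.Perm (Fin a) := e0.extendSubtype
  have hσ : ∀ i : Fin a, #{x | c x = i} = #{x | d x = σ i} := by
    intro i
    rw [h1 i, h3 (σ i)]
    congr 1
    by_cases hi : #{x | c x = i} = Fintype.card V / a + 1
    · rw [if_pos hi, if_pos (e0.extendSubtype_mem i hi)]
    · rw [if_neg hi, if_neg (e0.extendSubtype_not_mem i hi)]
  let c' : V → Fin a := fun x => ⟨c x, hc.1 x (by simp)⟩
  let d' : W → Fin a := fun x => ⟨d x, hd.1 x (by simp)⟩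
  have hfe : ∀ i : Fin a, Nonempty ({x // c' x = i} ≃ {x // d' x = σ i}) := by
    intro i
    refine ⟨Fintype.equivOfCardEq ?_⟩
    rw [Fintype.card_subtype, Fintype.card_subtype]
    simpa only [c', d', Fin.ext_iff] using hσ i
  let fe := fun i => (hfe i).some
  let e : V ≃ W := (Equiv.sigmaFiberEquiv c').symm.trans
    ((Equiv.sigmaCongr σ fe).trans (Equiv.sigmaFiberEquiv d'))
  have he : ∀ x, d' (e x) = σ (c' x) := fun x => (fe (c' x) ⟨x, rfl⟩).2
  refine ⟨⟨e, ?_⟩⟩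
  intro x y
  have key : d (e x) = d (e y) ↔ c x = c y := by
    have h5 : d' (e x) = d' (e y) ↔ c' x = c' y := by
      rw [he, he]; exact σ.injective.eq_iff
    simpa only [c', d', Fin.ext_iff] using h5
  rw [hc.2.1 x (by simp) y (by simp), hd.2.1 _ (by simp) _ (by simp), key, e.injective.ne_iff]

theorem bal_turan (n a : ℕ) (h : a = 0 → n = 0) :
    Bal (turanUnionOfCliques n a) univ a (fun x => x.val % a) := by
  refine ⟨?_, ?_, ?_⟩
  · intro x _
    exact Nat.mod_lt _ (Nat.pos_of_ne_zero fun h0 => by have := h h0; have := x.2; omega)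
  · intro x _ y _
    simp [turanUnionOfCliques, SimpleGraph.turanGraph]
  · intro i hi j hj
    have key : ∀ i < a, #{x : Fin n | x.val % a = i} = n / a + if i % a < n % a then 1 else 0 := by
      intro i hi
      rw [← Nat.count_modEq_card n (by omega : 0 < a) i, Nat.count_eq_card_filter_range]
      apply Finset.card_bij (fun x _ => x.val)
      · intro x hx
        simpa [Nat.ModEq, Nat.mod_eq_of_lt hi] using hx
      · intro x _ y _ hxy
        exact Fin.ext hxy
      · intro x hx
        simp only [Finset.mem_filter, Finset.mem_range, Nat.ModEq, Nat.mod_eq_of_lt hi] at hx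
        exact ⟨⟨x, hx.1⟩, by simpa using hx.2, rfl⟩
    rw [key i hi, key j hj]
    split_ifs <;> omega

theorem fib_iso {V W : Type*} [Fintype V] [Fintype W] (G : SimpleGraph V) (H : SimpleGraph W)
    (e : G ≃g H) : FF G univ = FF H univ := by
  unfold FF
  apply Finset.card_bij (fun s _ => s.map e.toEquiv.toEmbedding)
  · intro s hs
    simp only [Finset.mem_filter, Finset.powerset_univ, Finset.mem_univ, true_and] at hs ⊢
    intro x hx y hy
    obtain ⟨x, hx', rfl⟩ := Finset.mem_map.1 hx
    obtain ⟨y, hy', rfl⟩ := Finset.mem_map.1 hy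
    exact fun h => hs x hx' y hy' (e.map_adj_iff.1 h)
  · intro s _ t _ h
    exact Finset.map_injective _ h
  · intro t ht
    simp only [Finset.mem_filter, Finset.powerset_univ, Finset.mem_univ, true_and] at ht
    refine ⟨t.map e.symm.toEquiv.toEmbedding, ?_, ?_⟩
    · simp only [Finset.mem_filter, Finset.powerset_univ, Finset.mem_univ, true_and]
      intro x hx y hy
      obtain ⟨x, hx', rfl⟩ := Finset.mem_map.1 hx
      obtain ⟨y, hy', rfl⟩ := Finset.mem_map.1 hy
      exact fun h => ht x hx' y hy' (e.symm.map_adj_iff.1 h)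
    · ext x
      simp only [Finset.mem_map_equiv]
      change e (e.symm x) ∈ t ↔ x ∈ t
      simp

theorem stmt_18 {V : Type*} [Fintype V] (G : SimpleGraph V) (n α : ℕ)
    (hn : n = Fintype.card V) (hα : α = indepNum G) :
    fibIndex G ≤ fT n α ∧
      (fibIndex G = fT n α ↔ Nonempty (G ≃g turanUnionOfCliques n α)) := by
  have hF : fibIndex G = FF G univ := by
    simp [fibIndex, FF, Ind]
  have hI : ∀ s ⊆ (univ : Finset V), Ind G s → #s ≤ α := by
    intro s _ hs
    rw [hα]
    exact Finset.le_sup (f := Finset.card) (Finset.mem_filter.2 ⟨Finset.mem_univ s, hs⟩)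
  have h0 : α = 0 → n = 0 := by
    intro h
    rw [hn, Fintype.card_eq_zero_iff]
    refine ⟨fun x => ?_⟩
    have := hI {x} (by simp) (by simp [Ind])
    simp at this
    omega
  have hT := bal_turan n α h0
  obtain ⟨m1, m2⟩ := main_aux G univ α hI
  rw [Finset.card_univ, ← hn] at m1 m2
  rw [hF]
  refine ⟨m1, fun h => ?_, ?_⟩
  · obtain ⟨c, hc⟩ := m2 h
    exact bal_iso _ _ α c _ hc hT (by simp [hn])
  · rintro ⟨e⟩
    rw [fib_iso _ _ e, FF_bal _ _ _ _ hT]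
    simp
end
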